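/- arXiv:math/0005139 — 2 statements merged into one kernel-verified Lean document; each statement's English description precedes it below -/
import Mathlib

section
/- Let $E$ be an open subset of $\mathbb{C}$ and let $V$ be a finite-dimensional $\mathbb{C}$-vector space of functions $E \to \mathbb{C}$, each of which is analytic on $E$. Then for every compact subset $K \subseteq E$ there exists a natural number $n$ such that every $f \in V$ which is not identically zero on any connected component of $E$ meeting $K$ has at most $n$ zeros in $K$, counted with multiplicity; that is, $\sum_{z \in K} \operatorname{ord}_z(f) \le n$. In particular, if $E$ is connected, then every nonzero $f \in V$ has at most $n$ zeros in $K$, counted with multiplicity. -/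
/-- The extension by zero to `ℂ` of a function defined on `E`. On an open set `E` it has the same
germ as `f` at every point of `E`, so it serves to speak of local properties of `f`. -/
noncomputable def extendByZero {E : Set ℂ} (f : E → ℂ) : ℂ → ℂ :=
  Function.extend Subtype.val f 0

/-- The number of zeros in `K`, counted with multiplicity, of a function `f : E → ℂ` analytic on
the open set `E ⊇ K`: the sum over the points of `K` of the orders of vanishing, in `ℕ∞`. The sum
over the possibly infinite set `K` is the supremum of its finite partial sums; points where `f`
does not vanish contribute `0`, and a point near which `f` is identically zero contributes `⊤`. -/
noncomputable def zeroCount {E : Set ℂ} (f : E → ℂ) (K : Set ℂ) : ℕ∞ :=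
  ⨆ s : Finset K, ∑ z ∈ s, analyticOrderAt (extendByZero f) (z : ℂ)

/-- A function holomorphic on an open set which vanishes at `a` to order at least `n` is divisible
by `(z - a) ^ n`. -/
theorem exists_differentiableOn_eq_pow_mul {E : Set ℂ} (hE : IsOpen E) {a : ℂ} (ha : a ∈ E) (n : ℕ)
    {g : ℂ → ℂ} (hg : DifferentiableOn ℂ g E) (hn : (n : ℕ∞) ≤ analyticOrderAt g a) :
    ∃ h : ℂ → ℂ, DifferentiableOn ℂ h E ∧ ∀ z, g z = (z - a) ^ n * h z := by
  induction n generalizing g with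
  | zero => exact ⟨g, hg, fun z => by simp⟩
  | succ n ih =>
    have hga : g a = 0 := by
      apply apply_eq_zero_of_analyticOrderAt_ne_zero
      rintro h0
      rw [h0] at hn
      exact absurd hn (by simp)
    have hd : DifferentiableOn ℂ (dslope g a) E :=
      (Complex.differentiableOn_dslope (hE.mem_nhds ha)).2 hg
    have heq : ∀ z, g z = (z - a) * dslope g a z := fun z => by
      have := sub_smul_dslope g a z
      rw [hga, sub_zero, smul_eq_mul] at this
      exact this.symm
    have hord : analyticOrderAt g a = 1 + analyticOrderAt (dslope g a) a := by
      have h1 : g = (fun z => z - a) * dslope g a := funext heq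
      conv_lhs => rw [h1]
      rw [analyticOrderAt_mul (by fun_prop) (hd.analyticAt (hE.mem_nhds ha))]
      congr 1
      simp
    have hn' : (n : ℕ∞) ≤ analyticOrderAt (dslope g a) a := by
      rw [hord, Nat.cast_add, Nat.cast_one, add_comm] at hn
      exact (ENat.add_le_add_iff_left ENat.one_ne_top).1 hn
    obtain ⟨h, hh, hh'⟩ := ih hd hn'
    exact ⟨h, hh, fun z => by rw [heq z, hh' z]; ring⟩

/-- A function holomorphic on an open set is divisible by the polynomial with prescribed zeros, if
it vanishes at each of them at least to the prescribed order. -/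
theorem exists_differentiableOn_eq_prod_pow_mul {E : Set ℂ} (hE : IsOpen E) (s : Finset ℂ)
    (hs : ∀ a ∈ s, a ∈ E) (k : ℂ → ℕ) {f : ℂ → ℂ} (hf : DifferentiableOn ℂ f E)
    (hk : ∀ a ∈ s, (k a : ℕ∞) ≤ analyticOrderAt f a) :
    ∃ g : ℂ → ℂ, DifferentiableOn ℂ g E ∧ ∀ z, f z = (∏ a ∈ s, (z - a) ^ k a) * g z := by
  classical
  induction s using Finset.induction_on with
  | empty => exact ⟨f, hf, fun z => by simp⟩
  | insert b s hb ih =>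
    obtain ⟨g, hg, hfg⟩ := ih (fun a ha => hs a (Finset.mem_insert_of_mem ha))
      (fun a ha => hk a (Finset.mem_insert_of_mem ha))
    have hbE : b ∈ E := hs b (Finset.mem_insert_self _ _)
    have hP : AnalyticAt ℂ (fun z => ∏ a ∈ s, (z - a) ^ k a) b := by fun_prop
    have hP0 : analyticOrderAt (fun z => ∏ a ∈ s, (z - a) ^ k a) b = 0 := by
      rw [hP.analyticOrderAt_eq_zero]
      refine Finset.prod_ne_zero_iff.2 fun a ha => pow_ne_zero _ (sub_ne_zero.2 ?_)
      rintro rfl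
      exact hb ha
    have hord : (k b : ℕ∞) ≤ analyticOrderAt g b := by
      have h1 : f = (fun z => ∏ a ∈ s, (z - a) ^ k a) * g := funext hfg
      have h2 := hk b (Finset.mem_insert_self _ _)
      rwa [h1, analyticOrderAt_mul hP (hg.analyticAt (hE.mem_nhds hbE)), hP0, zero_add] at h2
    obtain ⟨h, hh, hgh⟩ := exists_differentiableOn_eq_pow_mul hE hbE (k b) hg hord
    refine ⟨h, hh, fun z => ?_⟩
    rw [hfg z, hgh z, Finset.prod_insert hb]
    ring

/-- A holomorphic function with `N` zeros in a disc of radius `r` is smaller there, by a factor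
`(2 / 3) ^ N`, than its maximum on the concentric disc of radius `4 * r`. -/
theorem norm_le_mul_pow_of_zeros {E : Set ℂ} (hE : IsOpen E) {c : ℂ} {r : ℝ} (hr : 0 < r)
    (hcE : Metric.closedBall c (4 * r) ⊆ E) {f : ℂ → ℂ} (hf : DifferentiableOn ℂ f E) {M : ℝ}
    (hM : ∀ z ∈ Metric.closedBall c (4 * r), ‖f z‖ ≤ M) (s : Finset ℂ)
    (hs : ∀ a ∈ s, a ∈ Metric.closedBall c r) (k : ℂ → ℕ)
    (hk : ∀ a ∈ s, (k a : ℕ∞) ≤ analyticOrderAt f a) {z : ℂ} (hz : z ∈ Metric.closedBall c r) :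
    ‖f z‖ ≤ M * (2 / 3) ^ (∑ a ∈ s, k a) := by
  have hrr : Metric.closedBall c r ⊆ Metric.closedBall c (4 * r) :=
    Metric.closedBall_subset_closedBall (by linarith)
  obtain ⟨g, hg, hfg⟩ := exists_differentiableOn_eq_prod_pow_mul hE s
    (fun a ha => hcE (hrr (hs a ha))) k hf hk
  set N := ∑ a ∈ s, k a with hN
  have hgM : ‖g z‖ ≤ M / (3 * r) ^ N := by
    have hcl : closure (Metric.ball c (4 * r)) = Metric.closedBall c (4 * r) :=
      closure_ball c (by positivity)
    refine Complex.norm_le_of_forall_mem_frontier_norm_le (U := Metric.ball c (4 * r))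
      Metric.isBounded_ball ?_ ?_ (by rw [hcl]; exact hrr hz)
    · exact DifferentiableOn.diffContOnCl (hg.mono (hcl ▸ hcE))
    · intro w hw
      rw [frontier_ball c (by positivity)] at hw
      rw [le_div_iff₀ (by positivity)]
      have hwM := hM w (Metric.sphere_subset_closedBall hw)
      rw [hfg w, norm_mul, norm_prod] at hwM
      have hP : (3 * r) ^ N ≤ ∏ a ∈ s, ‖(w - a) ^ k a‖ := by
        rw [hN, ← Finset.prod_pow_eq_pow_sum]
        refine Finset.prod_le_prod (fun a _ => by positivity) fun a ha => ?_
        rw [norm_pow]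
        refine pow_le_pow_left₀ (by positivity) ?_ _
        have h1 := hs a ha
        rw [Metric.mem_closedBall] at h1
        rw [Metric.mem_sphere] at hw
        have h2 := dist_triangle w a c
        rw [← dist_eq_norm]
        linarith
      calc ‖g w‖ * (3 * r) ^ N ≤ ‖g w‖ * ∏ a ∈ s, ‖(w - a) ^ k a‖ := by gcongr
        _ ≤ M := by rwa [mul_comm]
  have hP : ∏ a ∈ s, ‖(z - a) ^ k a‖ ≤ (2 * r) ^ N := by
    rw [hN, ← Finset.prod_pow_eq_pow_sum]
    refine Finset.prod_le_prod (fun a _ => by positivity) fun a ha => ?_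
    rw [norm_pow]
    refine pow_le_pow_left₀ (by positivity) ?_ _
    have h1 := hs a ha
    rw [Metric.mem_closedBall] at h1 hz
    have h2 := dist_triangle_right z a c
    rw [← dist_eq_norm]
    linarith
  rw [hfg z, norm_mul, norm_prod]
  calc (∏ a ∈ s, ‖(z - a) ^ k a‖) * ‖g z‖ ≤ (2 * r) ^ N * (M / (3 * r) ^ N) := by gcongr
    _ = M * (2 / 3) ^ N := by
      rw [mul_pow, mul_pow, div_pow]
      field_simp

/-- Two seminorms on a finite-dimensional space, induced by linear maps to normed spaces, are
comparable if the kernels are. -/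
theorem exists_norm_le_mul_norm_of_ker_le_ker {V X Y : Type*} [AddCommGroup V] [Module ℂ V]
    [FiniteDimensional ℂ V] [NormedAddCommGroup X] [NormedSpace ℂ X] [NormedAddCommGroup Y]
    [NormedSpace ℂ Y] (S : V →ₗ[ℂ] X) (T : V →ₗ[ℂ] Y)
    (h : LinearMap.ker S ≤ LinearMap.ker T) : ∃ C : ℝ, ∀ v, ‖T v‖ ≤ C * ‖S v‖ := by
  obtain ⟨σ, hσ⟩ := S.rangeRestrict.exists_rightInverse_of_surjective S.range_rangeRestrict
  refine ⟨‖(T ∘ₗ σ).toContinuousLinearMap‖, fun v => ?_⟩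
  have hv : T (σ (S.rangeRestrict v)) = T v := by
    rw [← sub_eq_zero, ← map_sub, ← LinearMap.mem_ker]
    apply h
    rw [LinearMap.mem_ker, map_sub, sub_eq_zero]
    exact congrArg Subtype.val (LinearMap.congr_fun hσ (S.rangeRestrict v))
  rw [← hv]
  exact (T ∘ₗ σ).toContinuousLinearMap.le_opNorm (S.rangeRestrict v)

theorem extendByZero_apply {E : Set ℂ} (f : E → ℂ) (z : E) : extendByZero f z = f z :=
  Subtype.val_injective.extend_apply f 0 z

/-- Restriction of a space of analytic functions to a compact subset of the domain. -/
noncomputable def restrictToCompact {E : Set ℂ} (V : Submodule ℂ (E → ℂ))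
    (hana : ∀ f ∈ V, AnalyticOnNhd ℂ (extendByZero f) E) {B : Set ℂ} (hB : B ⊆ E) :
    V →ₗ[ℂ] C(B, ℂ) where
  toFun f := ⟨fun z => extendByZero f.1 z,
    ((hana f.1 f.2).continuousOn.mono hB).domRestrict⟩
  map_add' f g := by
    ext z
    have h : ∀ u : E → ℂ, extendByZero u z = u ⟨z.1, hB z.2⟩ :=
      fun u => extendByZero_apply u ⟨z.1, hB z.2⟩
    change extendByZero (f.1 + g.1) z = extendByZero f.1 z + extendByZero g.1 z
    rw [h, h, h, Pi.add_apply]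
  map_smul' c f := by
    ext z
    have h : ∀ u : E → ℂ, extendByZero u z = u ⟨z.1, hB z.2⟩ :=
      fun u => extendByZero_apply u ⟨z.1, hB z.2⟩
    change extendByZero (c • f.1) z = c • extendByZero f.1 z
    rw [h, h, Pi.smul_apply]

/-- Near each point the number of zeros is bounded uniformly over the functions in the space whose
germ at that point does not vanish. -/
theorem exists_local_bound_sum_analyticOrderAt {E : Set ℂ} (hE : IsOpen E)
    (V : Submodule ℂ (E → ℂ)) [FiniteDimensional ℂ V]
    (hana : ∀ f ∈ V, AnalyticOnNhd ℂ (extendByZero f) E) {c : ℂ} (hc : c ∈ E) :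
    ∃ r : ℝ, 0 < r ∧ ∃ n : ℕ, ∀ f ∈ V, analyticOrderAt (extendByZero f) c ≠ ⊤ →
      ∀ s : Finset ℂ, (∀ a ∈ s, a ∈ Metric.closedBall c r) →
        ∑ a ∈ s, analyticOrderAt (extendByZero f) a ≤ (n : ℕ∞) := by
  obtain ⟨R, hR, hRE⟩ := Metric.nhds_basis_closedBall.mem_iff.1 (hE.mem_nhds hc)
  obtain ⟨r, rfl⟩ : ∃ r, R = 4 * r := ⟨R / 4, by ring⟩
  have hr : 0 < r := by linarith
  have hrr : Metric.closedBall c r ⊆ Metric.closedBall c (4 * r) :=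
    Metric.closedBall_subset_closedBall (by linarith)
  have hcR : c ∈ Metric.closedBall c (4 * r) := Metric.mem_closedBall_self hR.le
  have hpre : IsPreconnected (Metric.closedBall c (4 * r)) :=
    (convex_closedBall c (4 * r)).isPreconnected
  let S := restrictToCompact V hana (hrr.trans hRE)
  let T := restrictToCompact V hana hRE
  have hker : LinearMap.ker S ≤ LinearMap.ker T := by
    intro f hf
    rw [LinearMap.mem_ker] at hf ⊢
    have h0 : extendByZero f.1 =ᶠ[nhds c] 0 := by
      filter_upwards [Metric.closedBall_mem_nhds c hr] with z hz
      exact DFunLike.congr_fun hf ⟨z, hz⟩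
    ext z
    exact ((hana f.1 f.2).mono hRE).eqOn_zero_of_preconnected_of_eventuallyEq_zero hpre hcR h0 z.2
  obtain ⟨C, hC⟩ := exists_norm_le_mul_norm_of_ker_le_ker S T hker
  obtain ⟨n, hn⟩ : ∃ n : ℕ, |C| * (2 / 3 : ℝ) ^ n < 1 := by
    have h := (tendsto_pow_atTop_nhds_zero_of_lt_one (r := (2 / 3 : ℝ)) (by norm_num)
      (by norm_num)).const_mul |C|
    rw [mul_zero] at h
    exact (h.eventually (gt_mem_nhds one_pos)).exists
  refine ⟨r, hr, n, fun f hf hfc s hs => ?_⟩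
  have hfin : ∀ a ∈ s, analyticOrderAt (extendByZero f) a ≠ ⊤ := fun a ha =>
    ((hana f hf).mono hRE).analyticOrderAt_ne_top_of_isPreconnected hpre hcR (hrr (hs a ha)) hfc
  have hcoe : ∀ a ∈ s, ((analyticOrderNatAt (extendByZero f) a : ℕ) : ℕ∞)
      = analyticOrderAt (extendByZero f) a :=
    fun a ha => Nat.cast_analyticOrderNatAt (hfin a ha)
  rw [← Finset.sum_congr rfl hcoe, ← Nat.cast_sum, Nat.cast_le]
  by_contra! hlt
  set N := ∑ a ∈ s, analyticOrderNatAt (extendByZero f) a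
  have hS : ‖S ⟨f, hf⟩‖ ≤ ‖T ⟨f, hf⟩‖ * (2 / 3) ^ N := by
    rw [ContinuousMap.norm_le _ (by positivity)]
    intro z
    exact norm_le_mul_pow_of_zeros hE hr hRE (hana f hf).differentiableOn
      (fun w hw => (T ⟨f, hf⟩).norm_coe_le_norm ⟨w, hw⟩) s hs _ (fun a ha => (hcoe a ha).le) z.2
  have hT : 0 < ‖T ⟨f, hf⟩‖ := by
    rw [norm_pos_iff]
    intro h0
    apply hfc
    rw [analyticOrderAt_eq_top]
    filter_upwards [Metric.closedBall_mem_nhds c hR] with z hz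
    exact DFunLike.congr_fun h0 ⟨z, hz⟩
  have hpow : (2 / 3 : ℝ) ^ N ≤ (2 / 3) ^ n :=
    pow_le_pow_of_le_one (by norm_num) (by norm_num) hlt.le
  have : ‖T ⟨f, hf⟩‖ < ‖T ⟨f, hf⟩‖ := calc
    ‖T ⟨f, hf⟩‖ ≤ C * ‖S ⟨f, hf⟩‖ := hC _
    _ ≤ |C| * ‖S ⟨f, hf⟩‖ := by gcongr; exact le_abs_self C
    _ ≤ |C| * (‖T ⟨f, hf⟩‖ * (2 / 3) ^ n) := by gcongr; exact hS.trans (by gcongr)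
    _ = ‖T ⟨f, hf⟩‖ * (|C| * (2 / 3) ^ n) := by ring
    _ < ‖T ⟨f, hf⟩‖ * 1 := by gcongr
    _ = ‖T ⟨f, hf⟩‖ := mul_one _
  exact lt_irrefl _ this

/-- An analytic function that does not vanish identically on the connected component of a point has
finite order of vanishing there. -/
theorem analyticOrderAt_extendByZero_ne_top {E : Set ℂ} {f : E → ℂ}
    (hf : AnalyticOnNhd ℂ (extendByZero f) E) {z : E}
    (hz : ∃ w ∈ connectedComponent z, f w ≠ 0) : analyticOrderAt (extendByZero f) z ≠ ⊤ := by
  obtain ⟨w, hw, hfw⟩ := hz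
  intro htop
  rw [analyticOrderAt_eq_top] at htop
  have hpre : IsPreconnected (Subtype.val '' connectedComponent z) :=
    isPreconnected_connectedComponent.image _ continuous_subtype_val.continuousOn
  have hsub : Subtype.val '' connectedComponent z ⊆ E := Subtype.coe_image_subset E _
  have h := (hf.mono hsub).eqOn_zero_of_preconnected_of_eventuallyEq_zero hpre
    (Set.mem_image_of_mem _ mem_connectedComponent) htop (Set.mem_image_of_mem _ hw)
  rw [extendByZero_apply] at h
  exact hfw h

/-- Let `E ⊆ ℂ` be open and `V` a finite-dimensional vector space of analytic functions `E → ℂ`.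
For any compact `K ⊆ E` there is an `n` such that every `f ∈ V` that is not identically zero on any
connected component of `E` meeting `K` (for connected `E`, every nonzero `f ∈ V`) has at most `n`
zeros in `K`, counted with multiplicity. -/
theorem finite_dim_space_of_analytic_functions_bounded_zeros
    (E : Set ℂ) (hE : IsOpen E) (V : Submodule ℂ (E → ℂ)) (hV : FiniteDimensional ℂ V)
    (hana : ∀ f ∈ V, AnalyticOnNhd ℂ (extendByZero f) E)
    (K : Set ℂ) (hK : IsCompact K) (hKE : K ⊆ E) :
    ∃ n : ℕ, ∀ f ∈ V,
      (∀ z : E, (z : ℂ) ∈ K → ∃ w ∈ connectedComponent z, f w ≠ 0) →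
        zeroCount f K ≤ (n : ℕ∞) := by
  classical
  choose! r hr n hn using fun c (hc : c ∈ E) =>
    exists_local_bound_sum_analyticOrderAt hE V hana hc
  obtain ⟨t, htK, hKt⟩ := hK.elim_nhds_subcover (fun c => Metric.closedBall c (r c))
    fun c hc => Metric.closedBall_mem_nhds c (hr c (hKE hc))
  refine ⟨∑ c ∈ t, n c, fun f hf hfK => iSup_le fun s => ?_⟩
  have hle : ∀ z ∈ s, analyticOrderAt (extendByZero f) (z : ℂ) ≤
      ∑ c ∈ t, if (z : ℂ) ∈ Metric.closedBall c (r c) then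
        analyticOrderAt (extendByZero f) (z : ℂ) else 0 := by
    intro z _
    obtain ⟨c, hct, hzc⟩ := Set.mem_iUnion₂.1 (hKt z.2)
    refine le_trans ?_ (Finset.single_le_sum (fun _ _ => zero_le) hct)
    rw [if_pos hzc]
  refine (Finset.sum_le_sum hle).trans ?_
  rw [Finset.sum_comm, Nat.cast_sum]
  refine Finset.sum_le_sum fun c hc => ?_
  have hcE : c ∈ E := hKE (htK c hc)
  have h := hn c hcE f hf (analyticOrderAt_extendByZero_ne_top (z := ⟨c, hcE⟩) (hana f hf)
    (hfK ⟨c, hcE⟩ (htK c hc)))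
    ((s.map (Function.Embedding.subtype _)).filter (· ∈ Metric.closedBall c (r c)))
    (fun a ha => (Finset.mem_filter.1 ha).2)
  rwa [Finset.sum_filter, Finset.sum_map] at h
end

section
/- The polynomial $(32t^9 + 6t)^8 + (32t^8 + 7)^8 - (32t^9 + 10t)^8 - 21\cdot 2^{28}\,t^{40}$ in $\mathbb{Z}[t]$ has degree at most $32$. In particular, $(32t^9 + 6t)^8 + (32t^8 + 7)^8 - (32t^9 + 10t)^8 = 21\cdot 2^{28}\,t^{40} + p(t)$ for some polynomial $p \in \mathbb{Z}[t]$ of degree at most $32$. -/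
open Polynomial

/-- The part of `(32t⁹ + 6t)⁸ + (32t⁸ + 7)⁸ - (32t⁹ + 10t)⁸` below its leading term. -/
noncomputable def eighthPowerRemainder : Polynomial ℤ :=
  C 7002390528 * X ^ 32 + C 3506700288 * X ^ 24 +
    C 884895744 * X ^ 16 + C 112506624 * X ^ 8 + C 5764801

theorem degree_eighthPowerRemainder_le : eighthPowerRemainder.degree ≤ (32 : ℕ) := by
  unfold eighthPowerRemainder
  compute_degree
  norm_num

/-- The polynomial `(32t⁹ + 6t)⁸ + (32t⁸ + 7)⁸ - (32t⁹ + 10t)⁸ - 21·2²⁸·t⁴⁰` in `ℤ[t]` has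
degree at most `32`; in particular `(32t⁹ + 6t)⁸ + (32t⁸ + 7)⁸ - (32t⁹ + 10t)⁸` equals
`21·2²⁸·t⁴⁰` plus a polynomial of degree at most `32`. -/
theorem eighth_power_family_identity :
    ((32 * X ^ 9 + 6 * X) ^ 8 + (32 * X ^ 8 + 7) ^ 8 - (32 * X ^ 9 + 10 * X) ^ 8
        - 21 * 2 ^ 28 * X ^ 40 : Polynomial ℤ).degree ≤ (32 : ℕ) ∧
      ∃ p : Polynomial ℤ, p.degree ≤ (32 : ℕ) ∧
        ((32 * X ^ 9 + 6 * X) ^ 8 + (32 * X ^ 8 + 7) ^ 8 - (32 * X ^ 9 + 10 * X) ^ 8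
          : Polynomial ℤ) = 21 * 2 ^ 28 * X ^ 40 + p := by
  have h : ((32 * X ^ 9 + 6 * X) ^ 8 + (32 * X ^ 8 + 7) ^ 8 - (32 * X ^ 9 + 10 * X) ^ 8
      : Polynomial ℤ) = 21 * 2 ^ 28 * X ^ 40 + eighthPowerRemainder := by
    simp only [eighthPowerRemainder, map_ofNat]
    ring
  refine ⟨?_, eighthPowerRemainder, degree_eighthPowerRemainder_le, h⟩
  rw [h, add_sub_cancel_left]
  exact degree_eighthPowerRemainder_le
end
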